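/- (Parabolic case, normal-vector characterization.) Let γ(t) = Ψ(u(t), v(t)) be a nondegenerate curve on [a,b] with cosh(u(t)) sin(v(t)) − sinh(u(t)) > 0 and cosh(u(t)) sin(v(t)) − sinh(u(t)) + λ ≠ 0 for all t. Then γ is a critical point of the energy with density ρ(u,v) = cosh(u) sin(v) − sinh(u) + λ (a catenary with respect to the degenerate plane {y − z = 0}) if and only if its geodesic curvature satisfies κ(t) = − ⟨n(t), T⟩ / ( d(t) + λ ) for all t, where T = (0,1,1), n is the principal normal of γ, and d(t) = cosh(u(t)) sin(v(t)) − sinh(u(t)) is the distance from γ(t) to the plane {y − z = 0}. -/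

import Mathlib

noncomputable section

open Real

/-- Lorentzian inner product on `ℝ³`: `⟨p,q⟩ = p₁q₁ + p₂q₂ − p₃q₃`. -/
def lprod (p q : Fin 3 → ℝ) : ℝ := p 0 * q 0 + p 1 * q 1 - p 2 * q 2

/-- Determinant of the 3×3 matrix with rows `a`, `b`, `c`. -/
def det3 (a b c : Fin 3 → ℝ) : ℝ :=
  a 0 * (b 1 * c 2 - b 2 * c 1) - a 1 * (b 0 * c 2 - b 2 * c 0)
    + a 2 * (b 0 * c 1 - b 1 * c 0)

/-- Parametrization `Ψ` of the de Sitter plane `S₁² ⊂ L³`. -/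
def Psi (u v : ℝ) : Fin 3 → ℝ :=
  ![Real.cosh u * Real.cos v, Real.cosh u * Real.sin v, Real.sinh u]

/-- Lorentzian cross product, characterized by `lprod (lcross a b) c = det3 a b c`. -/
def lcross (a b : Fin 3 → ℝ) : Fin 3 → ℝ :=
  ![a 1 * b 2 - a 2 * b 1, a 2 * b 0 - a 0 * b 2, a 1 * b 0 - a 0 * b 1]

/-- The curve `t ↦ Ψ(u t, v t)`, restricted to `[a, b]`, is a critical point of the
energy `E[γ] = ∫ₐᵇ ρ(u(t), v(t)) |γ'(t)| dt` among variations fixing the endpoints. -/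
def IsCritical (ρ : ℝ → ℝ → ℝ) (ε : ℝ) (u v : ℝ → ℝ) (a b : ℝ) : Prop :=
  ∀ φ ψ : ℝ → ℝ, ContDiff ℝ (⊤ : ℕ∞) φ → ContDiff ℝ (⊤ : ℕ∞) ψ →
    φ a = 0 → φ b = 0 → ψ a = 0 → ψ b = 0 →
    deriv (fun s : ℝ => ∫ t in a..b,
      ρ (u t + s * φ t) (v t + s * ψ t) *
        Real.sqrt (ε * ((deriv v t + s * deriv ψ t) ^ 2 *
          Real.cosh (u t + s * φ t) ^ 2 - (deriv u t + s * deriv φ t) ^ 2))) 0 = 0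

/-- Differentiation under the integral sign for a parametric interval integral whose integrand is
jointly `C¹` in the parameter on a neighbourhood of the relevant segment. -/
theorem hasDerivAt_intervalIntegral_of_continuousOn {a b : ℝ} (hab : a ≤ b)
    {f f' : ℝ → ℝ → ℝ} {O : Set (ℝ × ℝ)} (hO : IsOpen O)
    (hseg : ∀ t ∈ Set.Icc a b, ((0 : ℝ), t) ∈ O)
    (hf : ContinuousOn (fun p : ℝ × ℝ => f p.1 p.2) O)
    (hf' : ContinuousOn (fun p : ℝ × ℝ => f' p.1 p.2) O)
    (hderiv : ∀ s t, (s, t) ∈ O → HasDerivAt (fun x => f x t) (f' s t) s) :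
    HasDerivAt (fun s => ∫ t in a..b, f s t) (∫ t in a..b, f' 0 t) 0 := by
  obtain ⟨A, B, hA, -, h0A, hB, hAB⟩ := generalized_tube_lemma (isCompact_singleton (x := (0 : ℝ)))
    (isCompact_Icc (a := a) (b := b)) hO
    (by rintro ⟨s, t⟩ ⟨rfl, ht⟩; exact hseg t ht)
  obtain ⟨δ, hδ, hball⟩ := Metric.nhds_basis_closedBall.mem_iff.1 (hA.mem_nhds (h0A rfl))
  have hsub : Metric.closedBall (0 : ℝ) δ ×ˢ Set.Icc a b ⊆ O :=
    (Set.prod_mono hball hB).trans hAB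
  obtain ⟨M, hM⟩ := ((isCompact_closedBall (0 : ℝ) δ).prod
    (isCompact_Icc (a := a) (b := b))).exists_bound_of_continuousOn (hf'.mono hsub)
  have hslice : ∀ {g : ℝ → ℝ → ℝ}, ContinuousOn (fun p : ℝ × ℝ => g p.1 p.2) O →
      ∀ s ∈ Metric.closedBall (0 : ℝ) δ, ContinuousOn (g s) (Set.Icc a b) := by
    intro g hg s hs
    exact hg.comp (f := fun t => (s, t)) (by fun_prop) (fun t ht => hsub ⟨hs, ht⟩)
  have hint : ∀ {g : ℝ → ℝ → ℝ}, ContinuousOn (fun p : ℝ × ℝ => g p.1 p.2) O →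
      ∀ s ∈ Metric.closedBall (0 : ℝ) δ, IntervalIntegrable (g s) MeasureTheory.volume a b := by
    intro g hg s hs
    exact ContinuousOn.intervalIntegrable (by rw [Set.uIcc_of_le hab]; exact hslice hg s hs)
  have h0 : (0 : ℝ) ∈ Metric.closedBall (0 : ℝ) δ := Metric.mem_closedBall_self hδ.le
  have hIoc : ∀ {t}, t ∈ Set.uIoc a b → t ∈ Set.Icc a b := by
    intro t ht
    rw [Set.uIoc_of_le hab] at ht
    exact Set.Ioc_subset_Icc_self ht
  refine (intervalIntegral.hasDerivAt_integral_of_dominated_loc_of_deriv_le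
    (bound := fun _ => M) (Metric.closedBall_mem_nhds (0 : ℝ) hδ) ?_ (hint hf 0 h0)
    (hint hf' 0 h0).def'.aestronglyMeasurable ?_ intervalIntegrable_const ?_).2
  · filter_upwards [Metric.closedBall_mem_nhds (0 : ℝ) hδ] with s hs
    exact (hint hf s hs).def'.aestronglyMeasurable
  · exact Filter.Eventually.of_forall fun t ht s hs => hM (s, t) ⟨hs, hIoc ht⟩
  · exact Filter.Eventually.of_forall fun t ht s hs => hderiv s t (hsub ⟨hs, hIoc ht⟩)

/-- Fundamental lemma of the calculus of variations on a compact interval. -/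
theorem eqOn_zero_of_integral_smooth_mul_eq_zero {a b : ℝ} (hab : a < b) {g : ℝ → ℝ}
    (hg : ContinuousOn g (Set.Icc a b))
    (h : ∀ χ : ℝ → ℝ, ContDiff ℝ (⊤ : ℕ∞) χ → χ a = 0 → χ b = 0 →
      ∫ t in a..b, χ t * g t = 0) :
    ∀ t ∈ Set.Icc a b, g t = 0 := by
  have key := isOpen_Ioo.ae_eq_zero_of_integral_contDiff_smul_eq_zero
    (U := Set.Ioo a b) (μ := MeasureTheory.volume) (f := g)
    ((hg.mono Set.Ioo_subset_Icc_self).locallyIntegrableOn measurableSet_Ioo) (by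
      intro χ hχ _ hsupp
      have hout : ∀ t, t ∉ Set.Ioo a b → χ t = 0 := fun t ht =>
        image_eq_zero_of_notMem_tsupport fun h' => ht (hsupp h')
      have := h χ hχ (hout a (by simp)) (hout b (by simp))
      rw [intervalIntegral.integral_of_le hab.le] at this
      rw [← this]
      symm
      apply MeasureTheory.setIntegral_eq_integral_of_forall_compl_eq_zero
      intro t ht
      rw [hout t fun h' => ht (Set.Ioo_subset_Ioc_self h'), zero_mul])
  refine MeasureTheory.Measure.eqOn_Icc_of_ae_eq (μ := MeasureTheory.volume) (f := g)
    (g := fun _ => 0) hab.ne ?_ hg continuousOn_const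
  rw [← MeasureTheory.restrict_Ioo_eq_restrict_Icc]
  exact (MeasureTheory.ae_restrict_iff' measurableSet_Ioo).2 key

/-- The Euler–Lagrange expression `ρ κ + ⟨n, T⟩` of the weighted length in coordinates: `ε cosh u`
times it, paired with the component `v' φ - u' ψ` of a variation, is the first variation. Here `C`, `S`
are `cosh u`, `sinh u`; `c`, `n` are `cos v`, `sin v`; `p, q, P, Q` are the first and second
derivatives of `u, v`; and `s` is the speed. -/
def lagrangeDefect (ε lam C S c n p q P Q s : ℝ) : ℝ :=
  ε * (C * n - S + lam) * (C * q * P - C * p * Q - 2 * S * p ^ 2 * q + S * C ^ 2 * q ^ 3) / s ^ 3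
    + (C * q * (S * n - C) + p * c) / s

theorem first_variation_identity {ε lam C S c n p q P Q s φ ψ φ' ψ' : ℝ}
    (hε : ε = 1 ∨ ε = -1) (hs : s ≠ 0) (hs2 : s ^ 2 = ε * (q ^ 2 * C ^ 2 - p ^ 2)) :
    ε * (S * p * n + C * (c * q) - C * p) * ((q * C ^ 2 * ψ - p * φ) / s)
      + ε * (C * n - S + lam) *
        (((Q * C ^ 2 + q * (2 * C * (S * p))) * ψ + q * C ^ 2 * ψ' - (P * φ + p * φ')) / s
        - (q * C ^ 2 * ψ - p * φ) *
          (ε * (2 * q * Q * C ^ 2 + q ^ 2 * (2 * C * (S * p)) - 2 * p * P) / (2 * s)) / s ^ 2)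
    = (S * φ * n + C * (c * ψ) - C * φ) * s
      + (C * n - S + lam) *
        (ε * (2 * q * ψ' * C ^ 2 + q ^ 2 * (2 * C * (S * φ)) - 2 * p * φ') / (2 * s))
      - (q * φ - p * ψ) * (ε * C * lagrangeDefect ε lam C S c n p q P Q s) := by
  unfold lagrangeDefect
  rcases hε with rfl | rfl
  · field_simp
    grind
  · field_simp
    grind

theorem hasDerivAt_Psi_comp {u v : ℝ → ℝ} {p q t : ℝ} (hu : HasDerivAt u p t)
    (hv : HasDerivAt v q t) :
    HasDerivAt (fun x => Psi (u x) (v x))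
      ![Real.sinh (u t) * p * Real.cos (v t) + Real.cosh (u t) * (-Real.sin (v t) * q),
        Real.sinh (u t) * p * Real.sin (v t) + Real.cosh (u t) * (Real.cos (v t) * q),
        Real.cosh (u t) * p] t := by
  rw [hasDerivAt_pi]
  intro i
  fin_cases i
  · exact hu.cosh.mul hv.cos
  · exact hu.cosh.mul hv.sin
  · exact hu.sinh

theorem hasDerivAt_deriv_Psi_comp {u v : ℝ → ℝ} (hu : Differentiable ℝ u)
    (hv : Differentiable ℝ v) {P Q t : ℝ} (hu' : HasDerivAt (deriv u) P t)
    (hv' : HasDerivAt (deriv v) Q t) :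
    HasDerivAt (deriv fun x => Psi (u x) (v x))
      ![(Real.cosh (u t) * deriv u t * deriv u t + Real.sinh (u t) * P) * Real.cos (v t)
          + Real.sinh (u t) * deriv u t * (-Real.sin (v t) * deriv v t)
          + (Real.sinh (u t) * deriv u t * (-Real.sin (v t) * deriv v t)
            + Real.cosh (u t) * (-(Real.cos (v t) * deriv v t) * deriv v t
              + -Real.sin (v t) * Q)),
        (Real.cosh (u t) * deriv u t * deriv u t + Real.sinh (u t) * P) * Real.sin (v t)
          + Real.sinh (u t) * deriv u t * (Real.cos (v t) * deriv v t)
          + (Real.sinh (u t) * deriv u t * (Real.cos (v t) * deriv v t)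
            + Real.cosh (u t) * (-Real.sin (v t) * deriv v t * deriv v t
              + Real.cos (v t) * Q)),
        Real.sinh (u t) * deriv u t * deriv u t + Real.cosh (u t) * P] t := by
  have hut := (hu t).hasDerivAt
  have hvt := (hv t).hasDerivAt
  rw [funext fun x => (hasDerivAt_Psi_comp (hu x).hasDerivAt (hv x).hasDerivAt).deriv,
    hasDerivAt_pi]
  intro i
  fin_cases i
  · exact ((hut.sinh.mul hu').mul hvt.cos).add (hut.cosh.mul (hvt.sin.neg.mul hv'))
  · exact ((hut.sinh.mul hu').mul hvt.sin).add (hut.cosh.mul (hvt.cos.mul hv'))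
  · exact hut.cosh.mul hu'

theorem geodesicCurvature_eq_iff_lagrangeDefect_eq_zero {u v : ℝ → ℝ} (hu : Differentiable ℝ u)
    (hv : Differentiable ℝ v) {t : ℝ} (hu' : DifferentiableAt ℝ (deriv u) t)
    (hv' : DifferentiableAt ℝ (deriv v) t) {ε lam s : ℝ} (hs : s ≠ 0)
    (hne : Real.cosh (u t) * Real.sin (v t) - Real.sinh (u t) + lam ≠ 0) :
    ε * det3 (Psi (u t) (v t)) (deriv (fun x => Psi (u x) (v x)) t)
          (deriv (deriv fun x => Psi (u x) (v x)) t) / s ^ 3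
        = -lprod ((-(1 / s)) • lcross (Psi (u t) (v t)) (deriv (fun x => Psi (u x) (v x)) t))
            ![(0 : ℝ), 1, 1] / (Real.cosh (u t) * Real.sin (v t) - Real.sinh (u t) + lam) ↔
      lagrangeDefect ε lam (Real.cosh (u t)) (Real.sinh (u t)) (Real.cos (v t)) (Real.sin (v t))
        (deriv u t) (deriv v t) (deriv (deriv u) t) (deriv (deriv v) t) s = 0 := by
  rw [(hasDerivAt_Psi_comp (hu t).hasDerivAt (hv t).hasDerivAt).deriv,
    (hasDerivAt_deriv_Psi_comp hu hv hu'.hasDerivAt hv'.hasDerivAt).deriv, eq_div_iff hne,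
    ← sub_eq_zero]
  have hC : Real.sinh (u t) ^ 2 = Real.cosh (u t) ^ 2 - 1 := Real.sinh_sq _
  have hc : Real.cos (v t) ^ 2 = 1 - Real.sin (v t) ^ 2 := Real.cos_sq' _
  simp only [det3, lprod, lcross, Psi, lagrangeDefect, Pi.smul_apply, smul_eq_mul,
    Matrix.cons_val]
  generalize Real.sinh (u t) = S at *
  generalize Real.cosh (u t) = C at *
  generalize Real.cos (v t) = c at *
  generalize Real.sin (v t) = n at *
  generalize deriv (deriv u) t = P
  generalize deriv (deriv v) t = Q
  generalize deriv u t = p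
  generalize deriv v t = q
  apply Eq.congr_left
  field_simp
  grind

/-- The first variation of the weighted length among nondegenerate curves on the de Sitter plane,
for the density `cosh u sin v - sinh u + lam`. -/
theorem hasDerivAt_energy {a b lam ε : ℝ} (hab : a < b) {u v φ ψ : ℝ → ℝ}
    (hε : ε = 1 ∨ ε = -1)
    (hu : ContDiff ℝ (⊤ : ℕ∞) u) (hv : ContDiff ℝ (⊤ : ℕ∞) v)
    (hφ : ContDiff ℝ (⊤ : ℕ∞) φ) (hψ : ContDiff ℝ (⊤ : ℕ∞) ψ)
    (hφa : φ a = 0) (hφb : φ b = 0) (hψa : ψ a = 0) (hψb : ψ b = 0)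
    (hnd : ∀ t ∈ Set.Icc a b,
      0 < ε * ((deriv v t) ^ 2 * Real.cosh (u t) ^ 2 - (deriv u t) ^ 2))
    {D : ℝ → ℝ}
    (hD : ∀ t, D t = lagrangeDefect ε lam (Real.cosh (u t)) (Real.sinh (u t))
      (Real.cos (v t)) (Real.sin (v t)) (deriv u t) (deriv v t)
      (deriv (deriv u) t) (deriv (deriv v) t)
      (Real.sqrt (ε * ((deriv v t) ^ 2 * Real.cosh (u t) ^ 2 - (deriv u t) ^ 2))))
    (hDc : ContinuousOn D (Set.Icc a b)) :
    HasDerivAt (fun s : ℝ => ∫ t in a..b,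
      (Real.cosh (u t + s * φ t) * Real.sin (v t + s * ψ t) - Real.sinh (u t + s * φ t) + lam) *
        Real.sqrt (ε * ((deriv v t + s * deriv ψ t) ^ 2 *
          Real.cosh (u t + s * φ t) ^ 2 - (deriv u t + s * deriv φ t) ^ 2)))
      (∫ t in a..b, (deriv v t * φ t - deriv u t * ψ t) * (ε * Real.cosh (u t) * D t)) 0 := by
  have cu := hu.continuous
  have cv := hv.continuous
  have cφ := hφ.continuous
  have cψ := hψ.continuous
  have smooth_deriv : ∀ {f : ℝ → ℝ}, ContDiff ℝ (⊤ : ℕ∞) f → ContDiff ℝ (⊤ : ℕ∞) (deriv f) :=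
    fun hf => (contDiff_infty_iff_deriv.1 hf).2
  have cu' := (smooth_deriv hu).continuous
  have cv' := (smooth_deriv hv).continuous
  have cφ' := (smooth_deriv hφ).continuous
  have cψ' := (smooth_deriv hψ).continuous
  have hasD : ∀ {f : ℝ → ℝ}, ContDiff ℝ (⊤ : ℕ∞) f → ∀ t, HasDerivAt f (deriv f t) t :=
    fun hf t => (hf.differentiable (by simp) t).hasDerivAt
  set W : ℝ → ℝ → ℝ := fun s t => ε * ((deriv v t + s * deriv ψ t) ^ 2 *
    Real.cosh (u t + s * φ t) ^ 2 - (deriv u t + s * deriv φ t) ^ 2) with hW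
  set f' : ℝ → ℝ → ℝ := fun s t =>
    (Real.sinh (u t + s * φ t) * φ t * Real.sin (v t + s * ψ t)
      + Real.cosh (u t + s * φ t) * (Real.cos (v t + s * ψ t) * ψ t)
      - Real.cosh (u t + s * φ t) * φ t) * Real.sqrt (W s t)
    + (Real.cosh (u t + s * φ t) * Real.sin (v t + s * ψ t) - Real.sinh (u t + s * φ t) + lam) *
      (ε * (2 * (deriv v t + s * deriv ψ t) * deriv ψ t * Real.cosh (u t + s * φ t) ^ 2
        + (deriv v t + s * deriv ψ t) ^ 2 *
          (2 * Real.cosh (u t + s * φ t) * (Real.sinh (u t + s * φ t) * φ t))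
        - 2 * (deriv u t + s * deriv φ t) * deriv φ t) / (2 * Real.sqrt (W s t))) with hf'
  have cW : Continuous fun p : ℝ × ℝ => W p.1 p.2 := by fun_prop
  have cf' : ContinuousOn (fun p : ℝ × ℝ => f' p.1 p.2) {p | 0 < W p.1 p.2} := by
    refine ContinuousOn.add (by fun_prop) (ContinuousOn.mul (by fun_prop)
      (ContinuousOn.div (by fun_prop) (by fun_prop) ?_))
    intro p hp
    exact mul_ne_zero two_ne_zero (Real.sqrt_pos.2 hp).ne'
  have hlin : ∀ (x y s : ℝ), HasDerivAt (fun s => x + s * y) y s := fun x y s => by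
    simpa using ((hasDerivAt_id s).mul_const y).const_add x
  have hseg : ∀ t ∈ Set.Icc a b, ((0 : ℝ), t) ∈ {p : ℝ × ℝ | 0 < W p.1 p.2} := by
    intro t ht
    simpa [hW] using hnd t ht
  have main := hasDerivAt_intervalIntegral_of_continuousOn hab.le (f := fun s t =>
      (Real.cosh (u t + s * φ t) * Real.sin (v t + s * ψ t) - Real.sinh (u t + s * φ t) + lam) *
        Real.sqrt (W s t)) (f' := f') (isOpen_lt continuous_const cW) hseg
    (Continuous.continuousOn (by fun_prop)) cf' (by
      intro s t hst
      have hst : W s t ≠ 0 := ne_of_gt hst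
      have d1 := hlin (u t) (φ t) s
      have d2 := hlin (v t) (ψ t) s
      have d3 := hlin (deriv u t) (deriv φ t) s
      have d4 := hlin (deriv v t) (deriv ψ t) s
      have dW := ((((d4.pow 2).mul (d1.cosh.pow 2)).sub (d3.pow 2)).const_mul ε).sqrt hst
      refine ((((d1.cosh.mul d2.sin).sub d1.sinh).add_const lam).mul dW).congr_deriv ?_
      simp only [hf', hW, Pi.mul_apply, Pi.pow_apply, Pi.sub_apply]
      push_cast
      ring)
  convert main using 1
  have c0 : ContinuousOn (f' 0) (Set.Icc a b) :=
    cf'.comp (f := fun t => ((0 : ℝ), t)) (by fun_prop) hseg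
  have cE : ContinuousOn (fun t => (deriv v t * φ t - deriv u t * ψ t) *
      (ε * Real.cosh (u t) * D t)) (Set.Icc a b) :=
    ContinuousOn.mul (by fun_prop) (ContinuousOn.mul (by fun_prop) hDc)
  have int0 : IntervalIntegrable (f' 0) MeasureTheory.volume a b :=
    ContinuousOn.intervalIntegrable (by rwa [Set.uIcc_of_le hab.le])
  have intE := ContinuousOn.intervalIntegrable (μ := MeasureTheory.volume) (a := a) (b := b)
    (by rwa [Set.uIcc_of_le hab.le])
  have boundary := intervalIntegral.integral_eq_sub_of_hasDerivAt (a := a) (b := b)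
    (f := fun t => ε * (Real.cosh (u t) * Real.sin (v t) - Real.sinh (u t) + lam) *
      ((deriv v t * Real.cosh (u t) ^ 2 * ψ t - deriv u t * φ t) /
        Real.sqrt (ε * ((deriv v t) ^ 2 * Real.cosh (u t) ^ 2 - (deriv u t) ^ 2))))
    (f' := fun t => f' 0 t - (deriv v t * φ t - deriv u t * ψ t) *
      (ε * Real.cosh (u t) * D t)) (by
      intro t ht
      rw [Set.uIcc_of_le hab.le] at ht
      have hWt := hnd t ht
      have hs : Real.sqrt (ε * ((deriv v t) ^ 2 * Real.cosh (u t) ^ 2 - (deriv u t) ^ 2)) ≠ 0 :=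
        (Real.sqrt_pos.2 hWt).ne'
      have hs2 := Real.sq_sqrt hWt.le
      have du := hasD hu t
      have dv := hasD hv t
      have du' := hasD (smooth_deriv hu) t
      have dv' := hasD (smooth_deriv hv) t
      have dφ := hasD hφ t
      have dψ := hasD hψ t
      have dW := ((((dv'.pow 2).mul (du.cosh.pow 2)).sub (du'.pow 2)).const_mul ε).sqrt hWt.ne'
      have dN := ((dv'.mul (du.cosh.pow 2)).mul dψ).sub (du'.mul dφ)
      refine (((((du.cosh.mul dv.sin).sub du.sinh).add_const lam).const_mul ε).mul
        (dN.div dW hs)).congr_deriv ?_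
      rw [hD]
      simp only [hf', hW, Pi.mul_apply, Pi.pow_apply, Pi.sub_apply, Pi.div_apply, zero_mul,
        add_zero]
      rw [← first_variation_identity hε hs hs2]
      push_cast
      field_simp)
    (int0.sub intE)
  rw [intervalIntegral.integral_sub int0 intE] at boundary
  simp only [hφa, hφb, hψa, hψb, mul_zero, sub_zero, zero_div] at boundary
  linarith

theorem parabolic_catenary_normal_characterization
    (a b lam : ℝ) (hab : a < b)
    (u v : ℝ → ℝ) (hu : ContDiff ℝ (⊤ : ℕ∞) u) (hv : ContDiff ℝ (⊤ : ℕ∞) v)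
    (ε : ℝ) (hε : ε = 1 ∨ ε = -1)
    (γ : ℝ → Fin 3 → ℝ) (hγ : ∀ t, γ t = Psi (u t) (v t))
    (sp : ℝ → ℝ)
    (hsp : ∀ t, sp t =
      Real.sqrt (ε * ((deriv v t) ^ 2 * Real.cosh (u t) ^ 2 - (deriv u t) ^ 2)))
    (hnd : ∀ t ∈ Set.Icc a b,
      0 < ε * ((deriv v t) ^ 2 * Real.cosh (u t) ^ 2 - (deriv u t) ^ 2))
    (κ : ℝ → ℝ)
    (hκ : ∀ t, κ t = ε * det3 (γ t) (deriv γ t) (deriv (deriv γ) t) / sp t ^ 3)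
    (n : ℝ → Fin 3 → ℝ) (hn : ∀ t, n t = (-(1 / sp t)) • lcross (γ t) (deriv γ t))
    (hd : ∀ t ∈ Set.Icc a b,
      0 < Real.cosh (u t) * Real.sin (v t) - Real.sinh (u t))
    (hne : ∀ t ∈ Set.Icc a b,
      Real.cosh (u t) * Real.sin (v t) - Real.sinh (u t) + lam ≠ 0) :
    IsCritical (fun x y => Real.cosh x * Real.sin y - Real.sinh x + lam) ε u v a b ↔
      ∀ t ∈ Set.Icc a b,
        κ t = -lprod (n t) ![(0 : ℝ), 1, 1]
          / (Real.cosh (u t) * Real.sin (v t) - Real.sinh (u t) + lam) := by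
  have hu' : ContDiff ℝ (⊤ : ℕ∞) (deriv u) := (contDiff_infty_iff_deriv.1 hu).2
  have hv' : ContDiff ℝ (⊤ : ℕ∞) (deriv v) := (contDiff_infty_iff_deriv.1 hv).2
  have cu := hu.continuous
  have cv := hv.continuous
  have cu' := hu'.continuous
  have cv' := hv'.continuous
  have cu'' : Continuous (deriv (deriv u)) := (contDiff_infty_iff_deriv.1 hu').2.continuous
  have cv'' : Continuous (deriv (deriv v)) := (contDiff_infty_iff_deriv.1 hv').2.continuous
  have hspne : ∀ t ∈ Set.Icc a b, sp t ≠ 0 := fun t ht => by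
    rw [hsp]; exact (Real.sqrt_pos.2 (hnd t ht)).ne'
  have csp : Continuous sp := by
    rw [funext hsp]; fun_prop
  set D : ℝ → ℝ := fun t => lagrangeDefect ε lam (Real.cosh (u t)) (Real.sinh (u t))
    (Real.cos (v t)) (Real.sin (v t)) (deriv u t) (deriv v t)
    (deriv (deriv u) t) (deriv (deriv v) t) (sp t) with hD
  have cD : ContinuousOn D (Set.Icc a b) := by
    unfold D lagrangeDefect
    exact ContinuousOn.add
      (ContinuousOn.div (by fun_prop) (by fun_prop) fun t ht => pow_ne_zero 3 (hspne t ht))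
      (ContinuousOn.div (by fun_prop) (by fun_prop) hspne)
  obtain rfl : γ = fun t => Psi (u t) (v t) := funext hγ
  have hcurv : (∀ t ∈ Set.Icc a b, κ t = -lprod (n t) ![(0 : ℝ), 1, 1]
      / (Real.cosh (u t) * Real.sin (v t) - Real.sinh (u t) + lam)) ↔
      ∀ t ∈ Set.Icc a b, D t = 0 := by
    refine forall₂_congr fun t ht => ?_
    rw [hκ, hn]
    exact geodesicCurvature_eq_iff_lagrangeDefect_eq_zero (hu.differentiable (by simp))
      (hv.differentiable (by simp)) (hu'.differentiable (by simp) t)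
      (hv'.differentiable (by simp) t) (hspne t ht) (hne t ht)
  rw [hcurv]
  have hvar : ∀ φ ψ : ℝ → ℝ, ContDiff ℝ (⊤ : ℕ∞) φ → ContDiff ℝ (⊤ : ℕ∞) ψ →
      φ a = 0 → φ b = 0 → ψ a = 0 → ψ b = 0 → _ := fun φ ψ hφ hψ hφa hφb hψa hψb =>
    (hasDerivAt_energy (lam := lam) hab hε hu hv hφ hψ hφa hφb hψa hψb hnd
      (D := D) (fun t => by rw [← hsp]) cD).deriv
  constructor
  · intro hcrit
    have hzero := eqOn_zero_of_integral_smooth_mul_eq_zero hab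
      (g := fun t => (deriv v t ^ 2 + deriv u t ^ 2) * (ε * Real.cosh (u t) * D t))
      (ContinuousOn.mul (by fun_prop) (ContinuousOn.mul (by fun_prop) cD)) (by
        intro χ hχ hχa hχb
        have hφ : ContDiff ℝ (⊤ : ℕ∞) fun t => χ t * deriv v t := hχ.mul hv'
        have hψ : ContDiff ℝ (⊤ : ℕ∞) fun t => -(χ t * deriv u t) := (hχ.mul hu').neg
        have h1 := hcrit _ _ hφ hψ (by simp [hχa]) (by simp [hχb]) (by simp [hχa])
          (by simp [hχb])
        have h2 := hvar _ _ hφ hψ (by simp [hχa]) (by simp [hχb]) (by simp [hχa])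
          (by simp [hχb])
        rw [← h1]
        refine Eq.trans ?_ h2.symm
        refine intervalIntegral.integral_congr fun t _ => ?_
        ring)
    intro t ht
    have hpos : 0 < deriv v t ^ 2 + deriv u t ^ 2 := by
      by_contra hle
      have hq : deriv v t ^ 2 = 0 := by nlinarith [sq_nonneg (deriv v t), sq_nonneg (deriv u t)]
      have hp : deriv u t ^ 2 = 0 := by nlinarith [sq_nonneg (deriv v t), sq_nonneg (deriv u t)]
      have := hnd t ht
      rw [hp, hq] at this
      simp at this
    have hε0 : ε ≠ 0 := by rcases hε with rfl | rfl <;> norm_num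
    simpa [hpos.ne', hε0, (Real.cosh_pos (u t)).ne'] using hzero t ht
  · intro hD0 φ ψ hφ hψ hφa hφb hψa hψb
    refine (hvar φ ψ hφ hψ hφa hφb hψa hψb).trans ?_
    rw [← intervalIntegral.integral_zero (a := a) (b := b) (μ := MeasureTheory.volume)]
    refine intervalIntegral.integral_congr fun t ht => ?_
    rw [Set.uIcc_of_le hab.le] at ht
    simp [hD0 t ht]
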